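/- Suppose each of A, B, C is coprime to MN and let B⁻¹ denote an integer inverse of B modulo MN. For k, l ∈ ℤ/(MN)ℤ set s = 2Ak − l. Then for every x : ℤ/(MN)ℤ → ℂ and every m ∈ ℤ/(MN)ℤ, (F_a⁻¹(D_{k,l}(F_a x)))[m] = e^{(2πi/(MN))(A k² − C m² − l k − k(B m + s) + C(m + B⁻¹ s)²)} · x[m + B⁻¹ s], where F_a⁻¹ is the inverse GDAFT given by (F_a⁻¹ x)[m] = (1/√(MN)) Σ_{n=0}^{MN−1} e^{−(2πi/(MN))(A n² + B n m + C m²)} x[n]. -/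

import Mathlib

open Finset

/-- e^{2πi t / Q} for an integer `t` and modulus `Q`. -/
noncomputable def eFrac (Q : ℕ) (t : ℤ) : ℂ :=
  Complex.exp (2 * Real.pi * Complex.I * (t : ℂ) / (Q : ℂ))

/-- Generalized discrete affine Fourier transform (GDAFT). -/
noncomputable def gdaft (M N : ℕ) (A B C : ℤ) (x : ZMod (M * N) → ℂ) :
    ZMod (M * N) → ℂ :=
  fun n => (Real.sqrt (M * N) : ℂ)⁻¹ *
    ∑ m ∈ Finset.range (M * N),
      eFrac (M * N) (A * (n.val : ℤ) ^ 2 + B * (n.val : ℤ) * (m : ℤ) + C * (m : ℤ) ^ 2) *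
        x (m : ZMod (M * N))

/-- Inverse GDAFT. -/
noncomputable def igdaft (M N : ℕ) (A B C : ℤ) (x : ZMod (M * N) → ℂ) :
    ZMod (M * N) → ℂ :=
  fun m => (Real.sqrt (M * N) : ℂ)⁻¹ *
    ∑ n ∈ Finset.range (M * N),
      eFrac (M * N) (-(A * (n : ℤ) ^ 2 + B * (n : ℤ) * (m.val : ℤ) + C * (m.val : ℤ) ^ 2)) *
        x (n : ZMod (M * N))

/-- The pulsone localized at `(k0, l0)`. -/
noncomputable def pulsone (M N : ℕ) (k0 l0 : ℕ) : ZMod (M * N) → ℂ :=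
  fun n => if n.val % M = k0 then
    (Real.sqrt N : ℂ)⁻¹ * eFrac N ((n.val / M : ℕ) * l0) else 0

/-- Cross-ambiguity function of two `MN`-periodic sequences. -/
noncomputable def amb (M N : ℕ) (y x : ZMod (M * N) → ℂ) (k l : ZMod (M * N)) : ℂ :=
  ((M * N : ℕ) : ℂ)⁻¹ * ∑ n ∈ Finset.range (M * N),
    y (n : ZMod (M * N)) * (starRingEnd ℂ) (x ((n : ZMod (M * N)) - k)) *
      eFrac (M * N) (-((l * ((n : ZMod (M * N)) - k)).val : ℤ))

/-- Delay-Doppler shift operator. -/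
noncomputable def ddShift (M N : ℕ) (k l : ZMod (M * N)) (x : ZMod (M * N) → ℂ) :
    ZMod (M * N) → ℂ :=
  fun n => x (n - k) * eFrac (M * N) ((l * (n - k)).val : ℤ)

/-- Inner product ⟨x, y⟩ = Σ x[n] conj(y[n]). -/
noncomputable def innerMN (M N : ℕ) (x y : ZMod (M * N) → ℂ) : ℂ :=
  ∑ n ∈ Finset.range (M * N),
    x (n : ZMod (M * N)) * (starRingEnd ℂ) (y (n : ZMod (M * N)))


theorem eFrac_eq_stdAddChar (Q : ℕ) [NeZero Q] (t : ℤ) :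
    eFrac Q t = ZMod.stdAddChar (t : ZMod Q) := by
  rw [ZMod.stdAddChar_coe, eFrac]

theorem eFrac_val (Q : ℕ) [NeZero Q] (a : ZMod Q) :
    eFrac Q (a.val : ℤ) = ZMod.stdAddChar a := by
  rw [eFrac_eq_stdAddChar, Int.cast_natCast, ZMod.natCast_zmod_val]

theorem sum_range_natCast_zmod {R : Type*} [AddCommMonoid R] (Q : ℕ) [NeZero Q]
    (f : ZMod Q → R) : ∑ n ∈ Finset.range Q, f (n : ZMod Q) = ∑ n : ZMod Q, f n := by
  refine Finset.sum_bij' (fun n _ => (n : ZMod Q)) (fun a _ => a.val) ?_ ?_ ?_ ?_ ?_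
  · simp
  · intro a _
    simpa using ZMod.val_lt a
  · intro n hn
    exact ZMod.val_cast_of_lt (Finset.mem_range.mp hn)
  · intro a _
    exact ZMod.natCast_zmod_val a
  · simp

theorem gdaft_apply (M N : ℕ) [NeZero (M * N)] (A B C : ℤ) (x : ZMod (M * N) → ℂ)
    (n : ZMod (M * N)) :
    gdaft M N A B C x n = (Real.sqrt (M * N) : ℂ)⁻¹ *
      ∑ m : ZMod (M * N), ZMod.stdAddChar
        ((A : ZMod (M * N)) * n ^ 2 + (B : ZMod (M * N)) * n * m + (C : ZMod (M * N)) * m ^ 2) *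
        x m := by
  rw [gdaft, ← sum_range_natCast_zmod]
  simp [eFrac_eq_stdAddChar]

theorem igdaft_apply (M N : ℕ) [NeZero (M * N)] (A B C : ℤ) (x : ZMod (M * N) → ℂ)
    (m : ZMod (M * N)) :
    igdaft M N A B C x m = (Real.sqrt (M * N) : ℂ)⁻¹ *
      ∑ n : ZMod (M * N), ZMod.stdAddChar
        (-((A : ZMod (M * N)) * n ^ 2 + (B : ZMod (M * N)) * n * m +
          (C : ZMod (M * N)) * m ^ 2)) * x n := by
  rw [igdaft, ← sum_range_natCast_zmod]
  simp only [eFrac_eq_stdAddChar]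
  push_cast
  simp only [ZMod.natCast_zmod_val]

/-- **Conjugation of the delay-Doppler shift by the GDAFT.** If `A`, `B`, `C` are each
coprime to `M*N` and `Binv` is an integer inverse of `B` modulo `M*N`, then with
`s = 2Ak − l` (in `ℤ/(MN)ℤ`),
`(F_a⁻¹ D_{k,l} F_a x)[m] = e^{(2πi/(MN))(Ak² − Cm² − lk − k(Bm+s) + C(m+B⁻¹s)²)} · x[m + B⁻¹s]`. -/
theorem igdaft_ddShift_gdaft (M N : ℕ) (hM : 0 < M) (hN : 0 < N) (A B C : ℤ)
    (hA : IsCoprime A ((M * N : ℕ) : ℤ)) (hB : IsCoprime B ((M * N : ℕ) : ℤ))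
    (hC : IsCoprime C ((M * N : ℕ) : ℤ))
    (Binv : ℤ) (hBinv : B * Binv ≡ 1 [ZMOD ((M * N : ℕ) : ℤ)]) :
    ∀ (x : ZMod (M * N) → ℂ) (k l : ZMod (M * N)) (s : ZMod (M * N)),
      s = 2 * (A : ZMod (M * N)) * k - l →
      ∀ m : ZMod (M * N),
        igdaft M N A B C (ddShift M N k l (gdaft M N A B C x)) m =
          eFrac (M * N)
            ((((A : ZMod (M * N)) * k ^ 2 - (C : ZMod (M * N)) * m ^ 2 - l * k -
                k * ((B : ZMod (M * N)) * m + s) +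
                (C : ZMod (M * N)) * (m + (Binv : ZMod (M * N)) * s) ^ 2).val : ℤ)) *
            x (m + (Binv : ZMod (M * N)) * s) := by
  classical
  intro x k l s hs m
  have : NeZero (M * N) := ⟨(Nat.mul_pos hM hN).ne'⟩
  have hBB : (B : ZMod (M * N)) * (Binv : ZMod (M * N)) = 1 := by
    have h := (ZMod.intCast_eq_intCast_iff _ _ _).mpr hBinv
    push_cast at h
    exact h
  have hsqrt : (Real.sqrt (M * N) : ℂ)⁻¹ * (Real.sqrt (M * N) : ℂ)⁻¹ *
      ((M * N : ℕ) : ℂ) = 1 := by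
    have h0 : ((M * N : ℕ) : ℂ) ≠ 0 := Nat.cast_ne_zero.mpr (NeZero.ne _)
    have h1 : (Real.sqrt (M * N) : ℂ) * (Real.sqrt (M * N) : ℂ) = ((M * N : ℕ) : ℂ) := by
      rw [← Complex.ofReal_mul, Real.mul_self_sqrt (by positivity)]
      push_cast
      rfl
    rw [← mul_inv, h1, inv_mul_cancel₀ h0]
  set j₀ := m + (Binv : ZMod (M * N)) * s with hj₀
  let c : ZMod (M * N) → ZMod (M * N) := fun j =>
    (A : ZMod (M * N)) * k ^ 2 - (C : ZMod (M * N)) * m ^ 2 - l * k -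
      (B : ZMod (M * N)) * k * j + (C : ZMod (M * N)) * j ^ 2
  have hzero (j : ZMod (M * N)) : (B : ZMod (M * N)) * (j - m) - s = 0 ↔ j = j₀ := by
    constructor
    · intro h
      linear_combination (Binv : ZMod (M * N)) * h - (j - m) * hBB
    · intro h
      linear_combination (B : ZMod (M * N)) * h + s * hBB
  have hc : (A : ZMod (M * N)) * k ^ 2 - (C : ZMod (M * N)) * m ^ 2 - l * k -
      k * ((B : ZMod (M * N)) * m + s) + (C : ZMod (M * N)) * j₀ ^ 2 = c j₀ := by
    linear_combination k * (hzero j₀).mpr rfl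
  have hterm (n j : ZMod (M * N)) :
      (ZMod.stdAddChar (-((A : ZMod (M * N)) * n ^ 2 + (B : ZMod (M * N)) * n * m +
          (C : ZMod (M * N)) * m ^ 2)) : ℂ) *
        (ZMod.stdAddChar ((A : ZMod (M * N)) * (n - k) ^ 2 + (B : ZMod (M * N)) * (n - k) * j +
          (C : ZMod (M * N)) * j ^ 2) * x j * ZMod.stdAddChar (l * (n - k))) =
      ZMod.stdAddChar (n * ((B : ZMod (M * N)) * (j - m) - s)) *
        (ZMod.stdAddChar (c j) * x j) := by
    have hexp : -((A : ZMod (M * N)) * n ^ 2 + (B : ZMod (M * N)) * n * m +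
          (C : ZMod (M * N)) * m ^ 2) + ((A : ZMod (M * N)) * (n - k) ^ 2 +
          (B : ZMod (M * N)) * (n - k) * j + (C : ZMod (M * N)) * j ^ 2) + l * (n - k) =
        n * ((B : ZMod (M * N)) * (j - m) - s) + c j := by
      simp only [c, hs]
      ring
    have h := congrArg (fun a => (ZMod.stdAddChar a : ℂ)) hexp
    simp only [AddChar.map_add_eq_mul] at h ⊢
    linear_combination x j * h
  rw [eFrac_val, hc, igdaft_apply]
  simp only [ddShift, gdaft_apply, eFrac_val]
  calc
    _ = (Real.sqrt (M * N) : ℂ)⁻¹ * (Real.sqrt (M * N) : ℂ)⁻¹ *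
        ∑ n : ZMod (M * N), ∑ j : ZMod (M * N),
          ZMod.stdAddChar (n * ((B : ZMod (M * N)) * (j - m) - s)) *
            (ZMod.stdAddChar (c j) * x j) := by
      conv_rhs => rw [mul_assoc, Finset.mul_sum]
      congr 1
      refine Finset.sum_congr rfl fun n _ => ?_
      simp only [← hterm, ← Finset.mul_sum, ← Finset.sum_mul]
      ring
    _ = (Real.sqrt (M * N) : ℂ)⁻¹ * (Real.sqrt (M * N) : ℂ)⁻¹ *
        (((M * N : ℕ) : ℂ) * (ZMod.stdAddChar (c j₀) * x j₀)) := by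
      rw [Finset.sum_comm]
      simp only [← Finset.sum_mul, AddChar.sum_mulShift _ (ZMod.isPrimitive_stdAddChar (M * N)),
        hzero, ZMod.card]
      simp
    _ = _ := by
      rw [← mul_assoc, hsqrt, one_mul]
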